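/- arXiv:funct-an/9608001 — 3 statements merged into one kernel-verified Lean document; each statement's English description precedes it below -/
import Mathlib

section
/- Let X be a compact Hausdorff space and let μ be a diffuse regular Borel probability measure on X. Then there exists a continuous function u : X → 𝕋 such that the pushforward measure of μ under u (i.e. the measure E ↦ μ(u⁻¹(E)) on Borel subsets E of 𝕋) is the Haar probability measure on 𝕋. -/
open MeasureTheory

open Set Filter Topology unitInterval

/-- The values of a power series with bounded coefficients along the substitution `sin s / 2`.
As a function of `s` it is analytic on the whole real line. -/
noncomputable def sinSeries (c : ℕ → ℝ) (s : ℝ) : ℝ :=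
  ∑' n, c n * (Real.sin s / 2) ^ n

lemma abs_sin_div_two_le (s : ℝ) : |Real.sin s / 2| ≤ 1 / 2 := by
  rw [abs_div, abs_two]
  have := Real.abs_sin_le_one s
  linarith

lemma norm_mul_sin_pow_le {a : ℝ} (ha : |a| ≤ 1) (s : ℝ) (n : ℕ) :
    ‖a * (Real.sin s / 2) ^ n‖ ≤ (1 / 2) ^ n := by
  rw [norm_mul, norm_pow, Real.norm_eq_abs, Real.norm_eq_abs]
  calc |a| * |Real.sin s / 2| ^ n ≤ 1 * (1 / 2) ^ n := by
        gcongr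
        exact abs_sin_div_two_le s
    _ = (1 / 2) ^ n := one_mul _

lemma summable_mul_sin_pow {c : ℕ → ℝ} (hc : ∀ n, |c n| ≤ 1) (s : ℝ) :
    Summable fun n ↦ c n * (Real.sin s / 2) ^ n :=
  summable_geometric_two.of_norm_bounded fun n ↦ norm_mul_sin_pow_le (hc n) s n

lemma hasFPowerSeriesOnBall_tsum_of_bounded {c : ℕ → ℝ} (hc : ∀ n, |c n| ≤ 1) :
    HasFPowerSeriesOnBall (fun t : ℝ ↦ ∑' n, c n * t ^ n) (.ofScalars ℝ c) 0 1 := by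
  have hsum {t : ℝ} (ht : |t| < 1) : Summable fun n ↦ c n * t ^ n := by
    refine (summable_geometric_of_lt_one (abs_nonneg t) ht).of_norm_bounded fun n ↦ ?_
    rw [norm_mul, norm_pow, Real.norm_eq_abs, Real.norm_eq_abs]
    exact mul_le_of_le_one_left (by positivity) (hc n)
  constructor
  · refine le_of_forall_lt_imp_le_of_dense fun r hr ↦ ?_
    lift r to NNReal using hr.ne_top
    apply FormalMultilinearSeries.le_radius_of_summable
    simpa using (hsum (t := r) (by simpa using hr)).norm
  · simp
  · intro y hy
    rw [← ENNReal.coe_one, Metric.eball_coe, NNReal.coe_one, mem_ball_zero_iff] at hy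
    simpa [mul_comm] using (hsum (by simpa using hy)).hasSum

lemma volume_sinSeries_eq_zero {c : ℕ → ℝ} (hc : ∀ n, |c n| ≤ 1) (hne : c ≠ 0) :
    volume {s | sinSeries c s = 0} = 0 := by
  have hps := hasFPowerSeriesOnBall_tsum_of_bounded hc
  have han : AnalyticOnNhd ℝ (sinSeries c) univ := by
    intro s _
    have hmem : Real.sin s / 2 ∈ Metric.eball (0 : ℝ) 1 := by
      rw [← ENNReal.coe_one, Metric.eball_coe, NNReal.coe_one, mem_ball_zero_iff]
      exact (abs_sin_div_two_le s).trans_lt (by norm_num)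
    have h1 : AnalyticAt ℝ (fun s ↦ Real.sin s / 2) s := by fun_prop
    exact AnalyticAt.comp (f := fun s ↦ Real.sin s / 2) (hps.analyticAt_of_mem hmem) h1
  rcases han.eqOn_zero_or_eventually_ne_zero_of_preconnected isPreconnected_univ with h | h
  · refine absurd ?_ hne
    have hz : (fun t : ℝ ↦ ∑' n, c n * t ^ n) =ᶠ[𝓝 0] 0 := by
      filter_upwards [Ioo_mem_nhds (show (-1 / 2 : ℝ) < 0 by norm_num)
        (show (0 : ℝ) < 1 / 2 by norm_num)] with t ht
      have := h (mem_univ (Real.arcsin (2 * t)))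
      rwa [sinSeries, Real.sin_arcsin (by linarith [ht.1]) (by linarith [ht.2]),
        mul_div_cancel_left₀ _ two_ne_zero] at this
    exact (FormalMultilinearSeries.ofScalars_series_eq_zero (E := ℝ)).1
      (hps.hasFPowerSeriesAt.eq_zero_of_eventually hz)
  · have := ae_restrict_le_codiscreteWithin (μ := (volume : Measure ℝ)) MeasurableSet.univ h
    rw [Measure.restrict_univ] at this
    simpa [compl_ofPred] using mem_ae_iff.1 this

lemma continuous_sinSeries :
    Continuous fun p : (ℕ → I) × ℝ ↦ sinSeries (fun n ↦ p.1 n) p.2 := by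
  refine continuous_tsum (u := fun n ↦ (1 / 2 : ℝ) ^ n) (fun n ↦ ?_) summable_geometric_two
    fun n p ↦ norm_mul_sin_pow_le ?_ _ n
  · fun_prop
  · rw [abs_of_nonneg (p.1 n).2.1]
    exact (p.1 n).2.2

/-- A probability measure on the Hilbert cube without atoms has a continuous real-valued image
without atoms. -/
lemma exists_continuous_real_map_nullSingletonClass_of_cube (ν : Measure (ℕ → I)) [IsProbabilityMeasure ν]
    [NullSingletonClass ν] :
    ∃ F : (ℕ → I) → ℝ, Continuous F ∧ NullSingletonClass (ν.map F) := by
  let F (s : ℝ) (z : ℕ → I) : ℝ := sinSeries (fun n ↦ z n) s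
  have hF : Continuous fun p : (ℕ → I) × ℝ ↦ F p.2 p.1 := continuous_sinSeries
  have hFs (s : ℝ) : Continuous (F s) := hF.comp (Continuous.prodMk_left s)
  let S : Set (((ℕ → I) × (ℕ → I)) × ℝ) := {p | F p.2 p.1.1 = F p.2 p.1.2}
  have hS : MeasurableSet S :=
    (isClosed_eq (hF.comp (by fun_prop : Continuous
        fun p : ((ℕ → I) × (ℕ → I)) × ℝ ↦ (p.1.1, p.2)))
      (hF.comp (by fun_prop : Continuous
        fun p : ((ℕ → I) × (ℕ → I)) × ℝ ↦ (p.1.2, p.2)))).measurableSet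
  have hdiag : ∀ᵐ p ∂(ν.prod ν), p.1 ≠ p.2 := by
    have : (ν.prod ν) {p | p.1 = p.2} = 0 := by
      rw [Measure.measure_prod_null (isClosed_eq continuous_fst continuous_snd).measurableSet]
      refine Eventually.of_forall fun x ↦ ?_
      simp [preimage]
    simpa [ae_iff] using this
  have hnull : ((ν.prod ν).prod volume) S = 0 := by
    rw [Measure.measure_prod_null hS]
    filter_upwards [hdiag] with p hp
    have hle (n : ℕ) : |(p.1 n : ℝ) - p.2 n| ≤ 1 := by
      have h1 := (p.1 n).2
      have h2 := (p.2 n).2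
      rw [abs_le]
      constructor <;> linarith [h1.1, h1.2, h2.1, h2.2]
    have hbd (z : ℕ → I) (n : ℕ) : |(z n : ℝ)| ≤ 1 := by
      rw [abs_of_nonneg (z n).2.1]
      exact (z n).2.2
    have hne : (fun n ↦ (p.1 n : ℝ) - p.2 n) ≠ 0 := fun h ↦
      hp (funext fun n ↦ Subtype.ext (sub_eq_zero.1 (congrFun h n)))
    refine measure_mono_null (fun s hs ↦ ?_) (volume_sinSeries_eq_zero hle hne)
    have hs' : F s p.1 = F s p.2 := hs
    change sinSeries _ s = 0
    simp only [sinSeries, sub_mul]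
    rw [(summable_mul_sin_pow (hbd p.1) s).tsum_sub (summable_mul_sin_pow (hbd p.2) s)]
    exact sub_eq_zero.2 hs'
  have hae : ∀ᵐ s : ℝ, (ν.prod ν) {p | F s p.1 = F s p.2} = 0 := by
    rw [← Measure.prod_swap, Measure.map_apply measurable_swap hS,
      Measure.measure_prod_null (measurable_swap hS)] at hnull
    exact hnull
  obtain ⟨s, hs⟩ := hae.exists
  refine ⟨F s, hFs s, ⟨fun t ↦ ?_⟩⟩
  rw [Measure.map_apply (hFs s).measurable (measurableSet_singleton t)]
  have : (ν.prod ν) ((F s ⁻¹' {t}) ×ˢ (F s ⁻¹' {t})) = 0 :=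
    measure_mono_null (fun p hp ↦ Eq.trans hp.1 (Eq.symm hp.2)) hs
  rw [Measure.prod_prod] at this
  exact mul_self_eq_zero.1 this

/-- A regular diffuse measure on a compact Hausdorff space has finite families of continuous
functions whose joint fibres have small measure. -/
lemma exists_finite_continuous_fiber_lt {X : Type*} [TopologicalSpace X] [CompactSpace X]
    [T2Space X] [MeasurableSpace X] [BorelSpace X] (μ : Measure X) [μ.OuterRegular]
    (hdiffuse : ∀ x : X, μ {x} = 0) {ε : ENNReal} (hε : 0 < ε) :
    ∃ T : Set C(X, I), T.Finite ∧ ∀ x, μ {y | ∀ g ∈ T, g y = g x} < ε := by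
  have key (x : X) : ∃ g : C(X, I), g x = 1 ∧ μ {y | g y ≠ 0} < ε := by
    obtain ⟨U, hxU, hU, hμU⟩ := ({x} : Set X).exists_isOpen_lt_of_lt (μ := μ) ε
      (by rwa [hdiffuse])
    replace hxU := singleton_subset_iff.1 hxU
    obtain ⟨f, hf0, hf1, hfI⟩ := exists_continuous_zero_one_of_isClosed hU.isClosed_compl
      (isClosed_singleton (x := x)) (by simpa using hxU)
    refine ⟨⟨fun y ↦ ⟨f y, hfI y⟩, by fun_prop⟩, Subtype.ext (hf1 rfl),
      (measure_mono fun y hy ↦ ?_).trans_lt hμU⟩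
    by_contra hyU
    exact hy (Subtype.ext (hf0 hyU))
  choose g hg1 hgε using key
  obtain ⟨t, ht⟩ := isCompact_univ.elim_finite_subcover (fun x ↦ {y | g x y ≠ 0})
    (fun x ↦ isOpen_ne_fun (g x).continuous continuous_const)
    (fun x _ ↦ mem_iUnion.2 ⟨x, by simp [hg1]⟩)
  refine ⟨g '' t, t.finite_toSet.image g, fun x ↦ ?_⟩
  obtain ⟨i, hit, hi⟩ := mem_iUnion₂.1 (ht (mem_univ x))
  refine (measure_mono fun y hy ↦ ?_).trans_lt (hgε i)
  change g i y ≠ 0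
  rw [hy (g i) (mem_image_of_mem g hit)]
  exact hi

/-- A diffuse regular probability measure on a compact Hausdorff space has a diffuse image on the
Hilbert cube under a continuous map. -/
lemma exists_continuous_cube_map_nullSingletonClass {X : Type*} [TopologicalSpace X] [CompactSpace X]
    [T2Space X] [MeasurableSpace X] [BorelSpace X] (μ : Measure X) [μ.OuterRegular]
    (hdiffuse : ∀ x : X, μ {x} = 0) :
    ∃ G : X → ℕ → I, Continuous G ∧ NullSingletonClass (μ.map G) := by
  choose T hTfin hT using fun k : ℕ ↦ exists_finite_continuous_fiber_lt μ hdiffuse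
    (ε := (k : ENNReal)⁻¹) (by simp)
  have hcount : (insert 0 (⋃ k, T k)).Countable :=
    (countable_iUnion fun k ↦ (hTfin k).countable).insert 0
  obtain ⟨g, hg⟩ := hcount.exists_eq_range (insert_nonempty _ _)
  have hcont : Continuous fun x n ↦ g n x := by fun_prop
  refine ⟨fun x n ↦ g n x, hcont, ⟨fun z ↦ ?_⟩⟩
  rw [Measure.map_apply hcont.measurable (measurableSet_singleton z)]
  rcases ((fun x n ↦ g n x) ⁻¹' {z}).eq_empty_or_nonempty with h | ⟨x, rfl⟩
  · rw [h, measure_empty]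
  by_contra hpos
  obtain ⟨k, hk⟩ := ENNReal.exists_inv_nat_lt hpos
  refine (hT k x).not_ge (hk.le.trans (measure_mono ?_))
  intro y hy f hf
  obtain ⟨n, rfl⟩ : f ∈ range g := hg ▸ mem_insert_of_mem 0 (mem_iUnion.2 ⟨k, hf⟩)
  exact congrFun hy n

lemma continuous_cdf (ρ : Measure ℝ) [IsProbabilityMeasure ρ] [NullSingletonClass ρ] :
    Continuous (ProbabilityTheory.cdf ρ) := by
  rw [continuous_iff_continuousAt]
  intro a
  have hmono := ProbabilityTheory.monotone_cdf ρ
  rw [hmono.continuousAt_iff_leftLim_eq_rightLim, StieltjesFunction.rightLim_eq]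
  have h := (ProbabilityTheory.cdf ρ).measure_singleton a
  rw [ProbabilityTheory.measure_cdf, measure_singleton, eq_comm, ENNReal.ofReal_eq_zero] at h
  exact le_antisymm (hmono.leftLim_le le_rfl) (by linarith)

/-- The probability integral transform. -/
lemma map_cdf_eq_volume_restrict (ρ : Measure ℝ) [IsProbabilityMeasure ρ] [NullSingletonClass ρ] :
    ρ.map (ProbabilityTheory.cdf ρ) = volume.restrict (Ioc 0 1) := by
  have hcont := continuous_cdf ρ
  have hmono := ProbabilityTheory.monotone_cdf ρ
  set F := ProbabilityTheory.cdf ρ with hF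
  have : IsProbabilityMeasure (ρ.map F) :=
    Measure.isProbabilityMeasure_map hcont.measurable.aemeasurable
  refine Measure.ext_of_Iic _ _ fun t ↦ ?_
  rw [Measure.map_apply hcont.measurable measurableSet_Iic,
    Measure.restrict_apply measurableSet_Iic, inter_comm, Ioc_inter_Iic, Real.volume_Ioc, sub_zero]
  rcases le_or_gt 1 t with ht1 | ht1
  · have : F ⁻¹' Iic t = univ :=
      eq_univ_of_forall fun x ↦ (ProbabilityTheory.cdf_le_one ρ x).trans ht1
    rw [this, inf_eq_left.2 ht1]
    simp
  rw [inf_eq_right.2 ht1.le]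
  rcases (F ⁻¹' Iic t).eq_empty_or_nonempty with hemp | hne
  · rw [hemp, measure_empty, eq_comm, ENNReal.ofReal_eq_zero]
    refine ge_of_tendsto (ProbabilityTheory.tendsto_cdf_atBot ρ) (Eventually.of_forall fun x ↦ ?_)
    by_contra! hx
    exact (hemp ▸ (show x ∈ F ⁻¹' Iic t from hx.le) : x ∈ (∅ : Set ℝ))
  obtain ⟨b, hb⟩ := ((ProbabilityTheory.tendsto_cdf_atTop ρ).eventually (lt_mem_nhds ht1)).exists
  have hbdd : BddAbove (F ⁻¹' Iic t) := ⟨b, fun x hx ↦ by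
    by_contra! hbx
    exact (hb.trans_le (hmono hbx.le)).not_ge hx⟩
  have hmem : F (sSup (F ⁻¹' Iic t)) ≤ t :=
    (isClosed_Iic.preimage hcont).csSup_mem hne hbdd
  have heq : F ⁻¹' Iic t = Iic (sSup (F ⁻¹' Iic t)) :=
    Subset.antisymm (fun x hx ↦ le_csSup hbdd hx) fun x hx ↦ (hmono hx).trans hmem
  have hge : t ≤ F (sSup (F ⁻¹' Iic t)) := by
    refine ge_of_tendsto (hcont.continuousAt.tendsto.mono_left
      (nhdsWithin_le_nhds (s := Ioi (sSup (F ⁻¹' Iic t))))) ?_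
    filter_upwards [self_mem_nhdsWithin] with x hx
    by_contra! hxt
    exact (le_csSup hbdd (show x ∈ F ⁻¹' Iic t from hxt.le)).not_gt hx
  rw [heq, ← ProbabilityTheory.ofReal_cdf, ← hF, le_antisymm hmem hge]

lemma surjective_toCircle : Function.Surjective (AddCircle.toCircle : UnitAddCircle → Circle) := by
  intro z
  refine ⟨((Complex.arg z / (2 * Real.pi) : ℝ) : UnitAddCircle), ?_⟩
  rw [AddCircle.toCircle_apply_mk, div_one, mul_div_cancel₀ _ (by positivity), Circle.exp_arg]

lemma map_toCircle_volume [MeasurableSpace Circle] [BorelSpace Circle] :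
    Measure.map AddCircle.toCircle (volume : Measure UnitAddCircle) =
      Measure.haarMeasure (⊤ : TopologicalSpace.PositiveCompacts Circle) := by
  have hmeas : Measurable (AddCircle.toCircle : UnitAddCircle → Circle) :=
    AddCircle.continuous_toCircle.measurable
  have : IsProbabilityMeasure (volume : Measure UnitAddCircle) :=
    ⟨by rw [AddCircle.measure_univ, ENNReal.ofReal_one]⟩
  set m := Measure.map AddCircle.toCircle (volume : Measure UnitAddCircle) with hm
  have : IsProbabilityMeasure m := Measure.isProbabilityMeasure_map hmeas.aemeasurable
  have : m.IsMulLeftInvariant := by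
    refine ⟨fun z ↦ ?_⟩
    obtain ⟨a, rfl⟩ := surjective_toCircle z
    rw [hm, Measure.map_map (measurable_const_mul _) hmeas]
    conv_rhs => rw [← map_add_left_eq_self (volume : Measure UnitAddCircle) a]
    rw [Measure.map_map hmeas (measurable_const_add a)]
    congr 1
    ext1 x
    exact (AddCircle.toCircle_add a x).symm
  rw [Measure.haarMeasure_unique m ⊤]
  simp

/-- If `X` is a compact Hausdorff space and `μ` is a diffuse regular Borel probability
measure on `X`, then there is a continuous map `u : X → 𝕋` to the unit circle pushing `μ`
forward to the normalized Haar measure on `𝕋`. -/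
theorem circle_pushforward_of_diffuse
    (X : Type*) [TopologicalSpace X] [CompactSpace X] [T2Space X]
    [MeasurableSpace X] [BorelSpace X]
    [MeasurableSpace Circle] [BorelSpace Circle]
    (μ : Measure X) [IsProbabilityMeasure μ] [μ.Regular]
    (hdiffuse : ∀ x : X, μ {x} = 0) :
    ∃ u : C(X, Circle),
      Measure.map u μ =
        Measure.haarMeasure (⊤ : TopologicalSpace.PositiveCompacts Circle) := by
  obtain ⟨G, hG, _⟩ := exists_continuous_cube_map_nullSingletonClass μ hdiffuse
  have := Measure.isProbabilityMeasure_map (μ := μ) hG.measurable.aemeasurable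
  obtain ⟨F, hF, _⟩ := exists_continuous_real_map_nullSingletonClass_of_cube (μ.map G)
  have := Measure.isProbabilityMeasure_map (μ := μ.map G) hF.measurable.aemeasurable
  have hcdf := continuous_cdf ((μ.map G).map F)
  have hmap := map_cdf_eq_volume_restrict ((μ.map G).map F)
  set Φ := ProbabilityTheory.cdf ((μ.map G).map F)
  have hΦ : Continuous (Φ ∘ F ∘ G) := hcdf.comp (hF.comp hG)
  have hmk := UnitAddCircle.measurePreserving_mk 0
  have hcirc := AddCircle.continuous_toCircle (T := 1)
  have hcoe : Continuous fun t : ℝ ↦ (t : UnitAddCircle) := AddCircle.continuous_mk' 1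
  refine ⟨⟨fun x ↦ AddCircle.toCircle (Φ (F (G x)) : UnitAddCircle),
    hcirc.comp (hcoe.comp hΦ)⟩, ?_⟩
  rw [← map_toCircle_volume, ← hmk.map_eq, zero_add, ← hmap,
    Measure.map_map hF.measurable hG.measurable,
    Measure.map_map hcdf.measurable (hF.comp hG).measurable,
    Measure.map_map hmk.measurable hΦ.measurable,
    Measure.map_map hcirc.measurable (hmk.measurable.comp hΦ.measurable)]
  rfl
end

section
/- Let A be a unital C*-algebra with a normalized trace τ, let B be a finite-dimensional C*-algebra such that there exists no unital *-algebra homomorphism from B onto ℂ (equivalently, B has no direct summand isomorphic to ℂ), and let ι : B → A be a unital *-homomorphism. Then there exist unitary elements u, v of A lying in the image of ι such that τ(u) = τ(v) = τ(v*·u) = 0; in particular {1, u, v} is an orthonormal set for the inner product ⟨a,b⟩ = τ(b*a). -/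
open scoped ComplexOrder

section StarRing

variable {R : Type*} [Ring R] [StarRing R]

/-- Murray–von Neumann equivalence: `p = w* w` and `q = w w*` for some `w`. -/
def MurrayVonNeumannEquiv (p q : R) : Prop :=
  ∃ w : R, star w * w = p ∧ w * star w = q

theorem MurrayVonNeumannEquiv.symm {p q : R} (h : MurrayVonNeumannEquiv p q) :
    MurrayVonNeumannEquiv q p := by
  obtain ⟨w, h₁, h₂⟩ := h
  exact ⟨star w, by simpa using h₂, by simpa using h₁⟩

theorem IsStarProjection.mul_eq_left_of_mul_eq_right {p q : R} (hp : IsStarProjection p)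
    (hq : IsStarProjection q) (h : p * q = q) : q * p = q := by
  simpa [hp.isSelfAdjoint.star_eq, hq.isSelfAdjoint.star_eq] using congrArg star h

end StarRing

section CStarAlgebra

variable {B : Type*} [CStarAlgebra B]

theorem mul_eq_self_of_star_mul_self {w p : B} (hp : IsStarProjection p)
    (h : star w * w = p) : w * p = w := by
  rw [← sub_eq_zero, ← CStarRing.star_mul_self_eq_zero_iff]
  have hpp : p * p = p := hp.isIdempotentElem
  simp only [star_sub, star_mul, hp.isSelfAdjoint.star_eq, mul_sub, sub_mul]
  simp only [mul_assoc, h, hpp]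
  simp only [← mul_assoc, h, hpp]
  simp

theorem mul_eq_self_of_mul_star_self {w q : B} (hq : IsStarProjection q)
    (h : w * star w = q) : q * w = w := by
  have := mul_eq_self_of_star_mul_self (w := star w) hq (by simpa using h)
  simpa [hq.isSelfAdjoint.star_eq] using congrArg star this

theorem MurrayVonNeumannEquiv.trans {p q r : B} (hq : IsStarProjection q)
    (h : MurrayVonNeumannEquiv p q) (h' : MurrayVonNeumannEquiv q r) :
    MurrayVonNeumannEquiv p r := by
  obtain ⟨w, h₁, h₂⟩ := h
  obtain ⟨x, h₃, h₄⟩ := h'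
  have hw := mul_eq_self_of_mul_star_self hq h₂
  have hx := mul_eq_self_of_star_mul_self hq h₃
  refine ⟨x * w, ?_, ?_⟩
  · calc star (x * w) * (x * w) = star w * ((star x * x) * w) := by simp [mul_assoc]
      _ = p := by rw [h₃, hw, h₁]
  · calc x * w * star (x * w) = x * (w * star w) * star x := by simp [mul_assoc]
      _ = r := by rw [h₂, hx, h₄]

/-- There are unitaries `u, v` of the corner at `e` with `φ u = φ v = φ (v* u) = 0`. -/
def HasOrthogonalUnitaries (φ : B →ₗ[ℂ] ℂ) (e : B) : Prop :=
  ∃ u v : B, star u * u = e ∧ u * star u = e ∧ star v * v = e ∧ v * star v = e ∧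
    φ u = 0 ∧ φ v = 0 ∧ φ (star v * u) = 0

theorem HasOrthogonalUnitaries.zero (φ : B →ₗ[ℂ] ℂ) : HasOrthogonalUnitaries φ 0 :=
  ⟨0, 0, by simp⟩

theorem HasOrthogonalUnitaries.add {φ : B →ₗ[ℂ] ℂ} {e f : B} (he : IsStarProjection e)
    (hf : IsStarProjection f) (hef : e * f = 0) (h : HasOrthogonalUnitaries φ e)
    (h' : HasOrthogonalUnitaries φ f) : HasOrthogonalUnitaries φ (e + f) := by
  have orth : ∀ x y : B, x * e = x → f * y = y → x * y = 0 := by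
    intro x y hx hy
    rw [← hx, ← hy, mul_assoc, ← mul_assoc e, hef, zero_mul, mul_zero]
  have hfe : f * e = 0 := by
    simpa [he.isSelfAdjoint.star_eq, hf.isSelfAdjoint.star_eq] using congrArg star hef
  have orth' : ∀ x y : B, x * f = x → e * y = y → x * y = 0 := by
    intro x y hx hy
    rw [← hx, ← hy, mul_assoc, ← mul_assoc f, hfe, zero_mul, mul_zero]
  have supp : ∀ {p x : B}, IsStarProjection p → star x * x = p → x * star x = p →
      (x * p = x ∧ p * x = x) ∧ (star x * p = star x ∧ p * star x = star x) := by
    intro p x hp h₁ h₂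
    have h₃ := mul_eq_self_of_star_mul_self hp h₁
    have h₄ := mul_eq_self_of_mul_star_self hp h₂
    refine ⟨⟨h₃, h₄⟩, ?_, ?_⟩
    · simpa [hp.isSelfAdjoint.star_eq] using congrArg star h₄
    · simpa [hp.isSelfAdjoint.star_eq] using congrArg star h₃
  obtain ⟨u, v, hu, hu', hv, hv', h₁, h₂, h₃⟩ := h
  obtain ⟨x, y, hx, hx', hy, hy', h₄, h₅, h₆⟩ := h'
  obtain ⟨⟨u₁, u₂⟩, u₃, u₄⟩ := supp he hu hu'
  obtain ⟨⟨v₁, v₂⟩, v₃, v₄⟩ := supp he hv hv'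
  obtain ⟨⟨x₁, x₂⟩, x₃, x₄⟩ := supp hf hx hx'
  obtain ⟨⟨y₁, y₂⟩, y₃, y₄⟩ := supp hf hy hy'
  refine ⟨u + x, v + y, ?_, ?_, ?_, ?_, by simp [h₁, h₄], by simp [h₂, h₅], ?_⟩
  · simp [mul_add, add_mul, hu, hx, orth _ _ u₃ x₂, orth' _ _ x₃ u₂]
  · simp [mul_add, add_mul, hu', hx', orth _ _ u₁ x₄, orth' _ _ x₁ u₄]
  · simp [mul_add, add_mul, hv, hy, orth _ _ v₃ y₂, orth' _ _ y₃ v₂]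
  · simp [mul_add, add_mul, hv', hy', orth _ _ v₁ y₄, orth' _ _ y₁ v₄]
  · simp [mul_add, add_mul, h₃, h₆, orth _ _ v₃ x₂, orth' _ _ y₃ u₂]

theorem MurrayVonNeumannEquiv.apply_eq {φ : B →ₗ[ℂ] ℂ} (hφ : ∀ a b, φ (a * b) = φ (b * a))
    {p q : B} (h : MurrayVonNeumannEquiv p q) : φ p = φ q := by
  obtain ⟨w, rfl, rfl⟩ := h
  exact hφ _ _

theorem HasOrthogonalUnitaries.add_of_equiv {φ : B →ₗ[ℂ] ℂ}
    (hφ : ∀ a b, φ (a * b) = φ (b * a)) {p q : B} (hp : IsStarProjection p)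
    (hq : IsStarProjection q) (hpq : p * q = 0) (h : MurrayVonNeumannEquiv p q) :
    HasOrthogonalUnitaries φ (p + q) := by
  have hφpq := h.apply_eq hφ
  obtain ⟨w, h₁, h₂⟩ := h
  have hp' : p * p = p := hp.isIdempotentElem
  have hq' : q * q = q := hq.isIdempotentElem
  have hqp : q * p = 0 := by
    simpa [hp.isSelfAdjoint.star_eq, hq.isSelfAdjoint.star_eq] using congrArg star hpq
  have hwp := mul_eq_self_of_star_mul_self hp h₁
  have hqw := mul_eq_self_of_mul_star_self hq h₂
  have hwq : w * q = 0 := by rw [← hwp, mul_assoc, hpq, mul_zero]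
  have hww : w * w = 0 := by
    nth_rw 2 [← hqw]
    rw [← mul_assoc, hwq, zero_mul]
  have hww' : star w * star w = 0 := by rw [← star_mul, hww, star_zero]
  have hsp : star w * p = 0 := by
    rw [← hqw, star_mul, hq.isSelfAdjoint.star_eq, mul_assoc, hqp, mul_zero]
  have hsq : star w * q = star w := by
    simpa [hq.isSelfAdjoint.star_eq] using congrArg star hqw
  have hφw : φ w = 0 := by rw [← hqw, hφ, hwq, map_zero]
  have hφw' : φ (star w) = 0 := by
    have : p * star w = star w := by
      simpa [hp.isSelfAdjoint.star_eq] using congrArg star hwp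
    rw [← this, hφ, hsp, map_zero]
  refine ⟨p - q, w + star w, ?_, ?_, ?_, ?_, by simp [hφpq], by simp [hφw, hφw'], ?_⟩
  · simp [mul_sub, sub_mul, hp.isSelfAdjoint.star_eq, hq.isSelfAdjoint.star_eq, hp', hq',
      hpq, hqp]
  · simp [mul_sub, sub_mul, hp.isSelfAdjoint.star_eq, hq.isSelfAdjoint.star_eq, hp', hq',
      hpq, hqp]
  · simp [mul_add, add_mul, h₁, h₂, hww, hww', add_comm]
  · simp [mul_add, add_mul, h₁, h₂, hww, hww', add_comm]
  · simp [mul_sub, add_mul, hwp, hwq, hsp, hsq, hφw, hφw']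

theorem HasOrthogonalUnitaries.add_add_of_equiv {φ : B →ₗ[ℂ] ℂ}
    (hφ : ∀ a b, φ (a * b) = φ (b * a)) {p q r : B} (hp : IsStarProjection p)
    (hq : IsStarProjection q) (hr : IsStarProjection r) (hpq : p * q = 0) (hpr : p * r = 0)
    (hqr : q * r = 0) (h : MurrayVonNeumannEquiv p q) (h' : MurrayVonNeumannEquiv p r) :
    HasOrthogonalUnitaries φ (p + q + r) := by
  have hφpq := h.apply_eq hφ
  have hφpr := h'.apply_eq hφ
  have hp' : p * p = p := hp.isIdempotentElem
  have hq' : q * q = q := hq.isIdempotentElem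
  have hr' : r * r = r := hr.isIdempotentElem
  have hqp : q * p = 0 := by
    simpa [hp.isSelfAdjoint.star_eq, hq.isSelfAdjoint.star_eq] using congrArg star hpq
  have hrp : r * p = 0 := by
    simpa [hp.isSelfAdjoint.star_eq, hr.isSelfAdjoint.star_eq] using congrArg star hpr
  have hrq : r * q = 0 := by
    simpa [hr.isSelfAdjoint.star_eq, hq.isSelfAdjoint.star_eq] using congrArg star hqr
  obtain ⟨ω, hω⟩ : ∃ ω : ℂ, IsPrimitiveRoot ω 3 := ⟨_, Complex.isPrimitiveRoot_exp 3 (by norm_num)⟩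
  have hω3 : ω ^ 3 = 1 := hω.pow_eq_one
  have hsum : 1 + ω + ω ^ 2 = 0 := by
    simpa [Finset.sum_range_succ] using hω.geom_sum_eq_zero (by norm_num)
  have hnorm : ‖ω‖ = 1 := hω.norm'_eq_one (by norm_num)
  have hconj : star ω = ω ^ 2 := by
    have h0 : ω ≠ 0 := hω.ne_zero (by norm_num)
    have h1 : ω * star ω = 1 := by
      have := Complex.mul_conj' ω
      simpa [hnorm] using this
    apply mul_left_cancel₀ h0
    rw [h1, ← hω3]
    ring
  have hω21 : ω ^ 2 * ω = 1 := by rw [← hω3]; ring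
  have hω12 : ω * ω ^ 2 = 1 := by rw [← hω3]; ring
  have hωω : ω * ω = ω ^ 2 := (sq ω).symm
  have hω22 : ω ^ 2 * ω ^ 2 = ω := by linear_combination ω * hω3
  have hconj2 : star (ω ^ 2) = ω := by rw [star_pow, hconj]; linear_combination ω * hω3
  have hu : star (p + ω • q + ω ^ 2 • r) = p + ω ^ 2 • q + ω • r := by
    simp only [star_add, star_smul, hconj, hconj2, hp.isSelfAdjoint.star_eq,
      hq.isSelfAdjoint.star_eq, hr.isSelfAdjoint.star_eq]
  have hv : star (p + ω ^ 2 • q + ω • r) = p + ω • q + ω ^ 2 • r := by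
    rw [← hu, star_star]
  have huv : (p + ω • q + ω ^ 2 • r) * (p + ω ^ 2 • q + ω • r) = p + q + r := by
    simp only [mul_add, add_mul, smul_mul_assoc, mul_smul_comm, smul_smul, hp', hq', hr', hpq,
      hpr, hqr, hqp, hrp, hrq, hω12, hω21, smul_zero, add_zero, zero_add, one_smul]
  have hvu : (p + ω ^ 2 • q + ω • r) * (p + ω • q + ω ^ 2 • r) = p + q + r := by
    simp only [mul_add, add_mul, smul_mul_assoc, mul_smul_comm, smul_smul, hp', hq', hr', hpq,
      hpr, hqr, hqp, hrp, hrq, hω12, hω21, smul_zero, add_zero, zero_add, one_smul]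
  have huu : (p + ω • q + ω ^ 2 • r) * (p + ω • q + ω ^ 2 • r) = p + ω ^ 2 • q + ω • r := by
    simp only [mul_add, add_mul, smul_mul_assoc, mul_smul_comm, smul_smul, hp', hq', hr', hpq,
      hpr, hqr, hqp, hrp, hrq, hω22, hωω, smul_zero, add_zero, zero_add]
  have hφu : φ (p + ω • q + ω ^ 2 • r) = 0 := by
    simp only [map_add, map_smul, ← hφpq, ← hφpr, smul_eq_mul]
    linear_combination φ p * hsum
  have hφv : φ (p + ω ^ 2 • q + ω • r) = 0 := by
    simp only [map_add, map_smul, ← hφpq, ← hφpr, smul_eq_mul]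
    linear_combination φ p * hsum
  exact ⟨p + ω • q + ω ^ 2 • r, p + ω ^ 2 • q + ω • r, by rw [hu, hvu], by rw [hu, huv],
    by rw [hv, huv], by rw [hv, hvu], hφu, hφv, by rw [hv, huu, hφv]⟩

theorem isStarProjection_sum {F : Finset B} (hF : ∀ p ∈ F, IsStarProjection p)
    (horth : (F : Set B).Pairwise fun p q ↦ p * q = 0) :
    IsStarProjection (∑ p ∈ F, p) := by
  classical
  refine ⟨?_, isSelfAdjoint_sum _ fun p hp ↦ (hF p hp).isSelfAdjoint⟩
  rw [IsIdempotentElem, Finset.sum_mul_sum]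
  refine Finset.sum_congr rfl fun p hp ↦ ?_
  rw [Finset.sum_eq_single_of_mem p hp fun q hq hne ↦ horth hp hq hne.symm]
  exact (hF p hp).isIdempotentElem

theorem HasOrthogonalUnitaries.sum {φ : B →ₗ[ℂ] ℂ} (hφ : ∀ a b, φ (a * b) = φ (b * a))
    (F : Finset B) (hF : ∀ p ∈ F, IsStarProjection p)
    (horth : (F : Set B).Pairwise fun p q ↦ p * q = 0)
    (hequiv : ∀ p ∈ F, ∃ q ∈ F, q ≠ p ∧ MurrayVonNeumannEquiv p q) :
    HasOrthogonalUnitaries φ (∑ p ∈ F, p) := by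
  classical
  induction F using Finset.strongInduction with
  | H F ih =>
  rcases F.eq_empty_or_nonempty with rfl | ⟨p, hp⟩
  · simpa using HasOrthogonalUnitaries.zero φ
  have split : ∀ S ⊆ F, S.Nonempty → HasOrthogonalUnitaries φ (∑ p ∈ S, p) →
      (∀ t ∈ F \ S, ∃ q ∈ F \ S, q ≠ t ∧ MurrayVonNeumannEquiv t q) →
      HasOrthogonalUnitaries φ (∑ p ∈ F, p) := by
    intro S hS hne hgood hrest
    have hsub : F \ S ⊆ F := Finset.sdiff_subset
    have horthS : (S : Set B).Pairwise fun p q ↦ p * q = 0 := horth.mono (by exact_mod_cast hS)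
    have horthR : ((F \ S : Finset B) : Set B).Pairwise fun p q ↦ p * q = 0 :=
      horth.mono (by exact_mod_cast hsub)
    have hR := ih (F \ S) (Finset.sdiff_ssubset hS hne) (fun p hp ↦ hF p (hsub hp)) horthR hrest
    rw [← Finset.sum_sdiff hS]
    refine hR.add (isStarProjection_sum (fun p hp ↦ hF p (hsub hp)) horthR)
      (isStarProjection_sum (fun p hp ↦ hF p (hS hp)) horthS) ?_ hgood
    rw [Finset.sum_mul_sum]
    refine Finset.sum_eq_zero fun a ha ↦ Finset.sum_eq_zero fun b hb ↦ ?_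
    rw [Finset.mem_sdiff] at ha
    exact horth ha.1 (hS hb) fun hab ↦ ha.2 (hab ▸ hb)
  obtain ⟨q, hq, hqp, hpq⟩ := hequiv p hp
  by_cases hrest : ∀ t ∈ F \ {p, q}, ∃ s ∈ F \ {p, q}, s ≠ t ∧ MurrayVonNeumannEquiv t s
  · refine split {p, q} (by grind) (by simp) ?_ hrest
    rw [Finset.sum_pair hqp.symm]
    exact .add_of_equiv hφ (hF p hp) (hF q hq) (horth hp hq hqp.symm) hpq
  · push Not at hrest
    obtain ⟨r, hr, hr'⟩ := hrest
    have hrF : r ∈ F := by grind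
    have hrp : r ≠ p := by grind
    have hrq : r ≠ q := by grind
    have hpr : MurrayVonNeumannEquiv p r := by
      obtain ⟨s, hs, hsr, hrs⟩ := hequiv r hrF
      by_cases hsp : s = p
      · exact (hsp ▸ hrs).symm
      by_cases hsq : s = q
      · exact hpq.trans (hF q hq) (hsq ▸ hrs).symm
      exact absurd hrs (hr' s (by grind) hsr)
    refine split {p, q, r} (by grind) (by simp) ?_ ?_
    · rw [Finset.sum_insert (by grind), Finset.sum_pair hrq.symm, ← add_assoc]
      exact .add_add_of_equiv hφ (hF p hp) (hF q hq) (hF r hrF) (horth hp hq hqp.symm)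
        (horth hp hrF hrp.symm) (horth hq hrF hrq.symm) hpq hpr
    · intro t ht
      have htF : t ∈ F := by grind
      obtain ⟨s, hs, hst, hts⟩ := hequiv t htF
      refine ⟨s, ?_, hst, hts⟩
      have hnot : ¬ MurrayVonNeumannEquiv t r := fun h ↦ hr' t (by grind) (by grind) h.symm
      have hsp : s ≠ p := by
        rintro rfl
        exact hnot (hts.trans (hF s hs) hpr)
      have hsq : s ≠ q := by
        rintro rfl
        exact hnot (hts.trans (hF s hs) (hpq.symm.trans (hF p hp) hpr))
      have hsr : s ≠ r := by
        rintro rfl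
        exact hnot hts
      grind

/-- A nonzero projection `p` whose corner `p B p` consists of the multiples of `p`. -/
structure IsMinimalProjection (p : B) : Prop where
  isStarProjection : IsStarProjection p
  ne_zero : p ≠ 0
  exists_smul : ∀ b : B, ∃ c : ℂ, p * b * p = c • p

theorem IsMinimalProjection.equiv_of_mul_mul_ne_zero {p q : B} (hp : IsMinimalProjection p)
    (hq : IsMinimalProjection q) {b : B} (hb : q * b * p ≠ 0) : MurrayVonNeumannEquiv p q := by
  have hp' : p * p = p := hp.isStarProjection.isIdempotentElem
  have hq' : q * q = q := hq.isStarProjection.isIdempotentElem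
  have hps := hp.isStarProjection.isSelfAdjoint.star_eq
  have hqs := hq.isStarProjection.isSelfAdjoint.star_eq
  obtain ⟨x, hx⟩ : ∃ x, x = q * b * p := ⟨_, rfl⟩
  rw [← hx] at hb
  have hxp : x * p = x := by rw [hx, mul_assoc, hp']
  have hqx : q * x = x := by rw [hx, mul_assoc, ← mul_assoc q q, hq']
  obtain ⟨c, hc⟩ := hp.exists_smul (star x * x)
  obtain ⟨d, hd⟩ := hq.exists_smul (x * star x)
  replace hc : star x * x = c • p := by
    have : p * star x = star x := by simpa [hps] using congrArg star hxp
    rw [← hc, ← mul_assoc p, this, mul_assoc, hxp]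
  replace hd : x * star x = d • q := by
    have : star x * q = star x := by simpa [hqs] using congrArg star hqx
    rw [← hd, mul_assoc q, mul_assoc x, this, ← mul_assoc, hqx]
  have hdc : d = c := by
    have h₁ : x * (star x * x) = c • x := by rw [hc, mul_smul_comm, hxp]
    rw [← mul_assoc, hd, smul_mul_assoc, hqx] at h₁
    exact smul_left_injective ℂ hb h₁
  subst hdc
  have hd0 : d ≠ 0 := by
    rintro rfl
    rw [zero_smul, CStarRing.star_mul_self_eq_zero_iff] at hc
    exact hb hc
  have hreal : star d = d := by
    have := congrArg star hc
    rw [star_mul, star_star, hc, star_smul, hps] at this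
    exact (smul_left_injective ℂ hp.ne_zero this).symm
  obtain ⟨t, rfl⟩ : ∃ t : ℝ, (t : ℂ) = d :=
    Complex.conj_eq_iff_real.mp hreal |>.imp fun _ h ↦ h.symm
  have ht0 : t ≠ 0 := by simpa using hd0
  have ht : 0 ≤ t := by
    refine spectrum_star_mul_self_nonneg (b := x) t ?_
    rw [spectrum.mem_iff]
    intro hunit
    apply hp.ne_zero
    refine hunit.mul_right_eq_zero.mp ?_
    rw [hc, sub_mul, smul_mul_assoc, hp', ← Algebra.smul_def, sub_eq_zero]
    simp
  have hsqrt : ((Real.sqrt t)⁻¹ : ℂ) * ((Real.sqrt t)⁻¹ : ℂ) * t = 1 := by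
    norm_cast
    rw [← mul_inv, Real.mul_self_sqrt ht, inv_mul_cancel₀ ht0]
  refine ⟨((Real.sqrt t)⁻¹ : ℂ) • x, ?_, ?_⟩
  · rw [star_smul, smul_mul_smul_comm, hc, smul_smul, star_inv₀, Complex.star_def,
      Complex.conj_ofReal, hsqrt, one_smul]
  · rw [star_smul, smul_mul_smul_comm, hd, smul_smul, star_inv₀, Complex.star_def,
      Complex.conj_ofReal, hsqrt, one_smul]

/-- A minimal projection `p` with `p b p = b p` for all `b` gives a character. -/
theorem IsMinimalProjection.nonempty_starAlgHom {p : B} (hp : IsMinimalProjection p)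
    (hcentral : ∀ b : B, p * b * p = b * p) : Nonempty (B →⋆ₐ[ℂ] ℂ) := by
  have hps := hp.isStarProjection.isSelfAdjoint.star_eq
  choose c hc using hp.exists_smul
  have hc' : ∀ b, b * p = c b • p := fun b ↦ by rw [← hcentral, hc]
  have inj : ∀ {x y : ℂ}, x • p = y • p → x = y := fun h ↦ smul_left_injective ℂ hp.ne_zero h
  have halg : ∀ r : ℂ, c (algebraMap ℂ B r) = r := fun r ↦
    inj (by rw [← hc', ← Algebra.smul_def])
  exact ⟨{
    toFun := c
    map_one' := inj (by rw [← hc', one_mul, one_smul])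
    map_mul' := fun a b ↦ inj (by
      rw [← hc', mul_assoc, hc' b, mul_smul_comm, hc' a, smul_smul, mul_comm])
    map_zero' := inj (by rw [← hc', zero_mul, zero_smul])
    map_add' := fun a b ↦ inj (by rw [← hc', add_mul, hc', hc', add_smul])
    commutes' := halg
    map_star' := fun b ↦ inj (by
      rw [← hc]
      simpa [hps, mul_assoc] using congrArg star (hc b)) }⟩

variable [FiniteDimensional ℂ B]

theorem finite_spectrum_real (a : B) : (spectrum ℝ a).Finite := by
  have : FiniteDimensional ℝ B := FiniteDimensional.complexToReal B
  refine (Module.End.finite_spectrum (Algebra.lmul ℝ B a)).subset fun r hr hunit ↦ hr ?_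
  rw [spectrum.mem_resolventSet_iff] at hunit ⊢
  rw [← AlgHom.commutes (Algebra.lmul ℝ B), ← map_sub] at hunit
  have hbij := (Module.End.isUnit_iff _).mp hunit
  obtain ⟨y, hy⟩ := hbij.2 1
  replace hy : (algebraMap ℝ B r - a) * y = 1 := hy
  refine ⟨⟨_, y, hy, hbij.1 ?_⟩, rfl⟩
  change (algebraMap ℝ B r - a) * (y * (algebraMap ℝ B r - a)) = (algebraMap ℝ B r - a) * 1
  rw [← mul_assoc, hy, one_mul, mul_one]

/-- A spectral projection at a nonzero point of the spectrum. -/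
theorem IsSelfAdjoint.exists_isStarProjection_mul_eq_smul {a : B} (ha : IsSelfAdjoint a)
    (ha0 : a ≠ 0) :
    ∃ (q : B) (r : ℝ), IsStarProjection q ∧ q ≠ 0 ∧ r ≠ 0 ∧ a * q = r • q := by
  have hcont : ∀ g : ℝ → ℝ, ContinuousOn g (spectrum ℝ a) := fun g ↦
    (finite_spectrum_real a).continuousOn g
  obtain ⟨r, hr, hr0⟩ : ∃ r ∈ spectrum ℝ a, r ≠ 0 := by
    by_contra! h
    apply ha0
    calc a = cfc (id : ℝ → ℝ) a := (cfc_id ℝ a).symm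
      _ = cfc (fun _ : ℝ ↦ (0 : ℝ)) a := cfc_congr fun x hx ↦ h x hx
      _ = 0 := by simp
  let g : ℝ → ℝ := fun x ↦ if x = r then 1 else 0
  refine ⟨cfc g a, r, ⟨?_, cfc_predicate g a⟩, ?_, hr0, ?_⟩
  · rw [IsIdempotentElem, ← cfc_mul g g a (hcont _) (hcont _)]
    congr 1
    ext x
    simp [g]
  · intro h
    have hmem : (1 : ℝ) ∈ spectrum ℝ (cfc g a) := by
      rw [cfc_map_spectrum g a ha (hcont _)]
      exact ⟨r, hr, by simp [g]⟩
    rw [h] at hmem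
    have : Nontrivial B := ⟨a, 0, ha0⟩
    simp at hmem
  · nth_rw 1 [← cfc_id ℝ a]
    rw [← cfc_mul _ _ a (hcont _) (hcont _), ← cfc_smul _ _ a (hcont _)]
    congr 1
    ext x
    by_cases hx : x = r <;> simp [g, hx]

theorem IsStarProjection.isMinimalProjection_of_forall {f : B} (hf : IsStarProjection f)
    (hf0 : f ≠ 0) (hmin : ∀ q : B, IsStarProjection q → f * q = q → q ≠ 0 → q = f) :
    IsMinimalProjection f := by
  have hff : f * f = f := hf.isIdempotentElem
  have hsa : ∀ a : B, IsSelfAdjoint a → ∃ r : ℝ, f * a * f = r • f := by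
    intro a ha
    have hfaf : IsSelfAdjoint (f * a * f) := by
      simpa [hf.isSelfAdjoint.star_eq] using ha.conjugate f
    by_cases h0 : f * a * f = 0
    · exact ⟨0, by rw [h0, zero_smul]⟩
    obtain ⟨q, r, hq, hq0, hr0, hqr⟩ := hfaf.exists_isStarProjection_mul_eq_smul h0
    have hfq : f * q = q := by
      apply smul_right_injective B hr0
      change r • (f * q) = r • q
      rw [← mul_smul_comm, ← hqr]
      simp only [← mul_assoc, hff]
    obtain rfl := hmin q hq hfq hq0
    exact ⟨r, by rw [← hqr, mul_assoc _ q q, hff]⟩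
  refine ⟨hf, hf0, fun b ↦ ?_⟩
  obtain ⟨s, hs⟩ := hsa _ (realPart b).2
  obtain ⟨t, ht⟩ := hsa _ (imaginaryPart b).2
  refine ⟨s + Complex.I * t, ?_⟩
  rw [← realPart_add_I_smul_imaginaryPart b, mul_add, add_mul, hs, mul_smul_comm,
    smul_mul_assoc, ht, add_smul, mul_smul]
  simp

theorem IsStarProjection.finrank_range_mulLeft_lt {f q : B} (hf : IsStarProjection f)
    (hq : IsStarProjection q) (hfq : f * q = q) (hne : q ≠ f) :
    Module.finrank ℂ (LinearMap.range (LinearMap.mulLeft ℂ q)) <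
      Module.finrank ℂ (LinearMap.range (LinearMap.mulLeft ℂ f)) := by
  apply Submodule.finrank_lt_finrank_of_lt
  refine lt_of_le_of_ne ?_ fun h ↦ hne ?_
  · rintro _ ⟨b, rfl⟩
    exact ⟨q * b, by simp [← mul_assoc, hfq]⟩
  · obtain ⟨b, hb⟩ : f ∈ LinearMap.range (LinearMap.mulLeft ℂ q) := h ▸ ⟨1, by simp⟩
    replace hb : q * b = f := hb
    have hqq : q * q = q := hq.isIdempotentElem
    rw [← hf.mul_eq_left_of_mul_eq_right hq hfq, ← hb, ← mul_assoc, hqq]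

theorem IsStarProjection.exists_sum_isMinimalProjection (f : B) (hf : IsStarProjection f) :
    ∃ F : Finset B, (∀ p ∈ F, IsMinimalProjection p) ∧
      ((F : Set B).Pairwise fun p q ↦ p * q = 0) ∧ ∑ p ∈ F, p = f := by
  classical
  induction hn : Module.finrank ℂ (LinearMap.range (LinearMap.mulLeft ℂ f))
    using Nat.strong_induction_on generalizing f with
  | _ n ih =>
  subst hn
  by_cases hf0 : f = 0
  · exact ⟨∅, by simp [hf0]⟩
  by_cases hmin : ∀ q : B, IsStarProjection q → f * q = q → q ≠ 0 → q = f
  · exact ⟨{f}, by simpa using hf.isMinimalProjection_of_forall hf0 hmin, by simp, by simp⟩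
  push Not at hmin
  obtain ⟨q, hq, hfq, hq0, hne⟩ := hmin
  have hff : f * f = f := hf.isIdempotentElem
  have hqq : q * q = q := hq.isIdempotentElem
  have hqf := hf.mul_eq_left_of_mul_eq_right hq hfq
  have hr : IsStarProjection (f - q) := hq.sub_of_mul_eq_left hf hqf
  obtain ⟨F, hF, hForth, hFsum⟩ := ih _ (hf.finrank_range_mulLeft_lt hq hfq hne) q hq rfl
  obtain ⟨G, hG, hGorth, hGsum⟩ := ih _ (hf.finrank_range_mulLeft_lt hr
    (by rw [mul_sub, hff, hfq]) (by simpa using hq0)) (f - q) hr rfl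
  have hsupp : ∀ {H : Finset B} {e : B}, (∀ p ∈ H, IsMinimalProjection p) →
      ((H : Set B).Pairwise fun p q ↦ p * q = 0) → ∑ p ∈ H, p = e →
      ∀ p ∈ H, e * p = p ∧ p * e = p := by
    rintro H _ hH horth rfl p hp
    have hpp : p * p = p := (hH p hp).isStarProjection.isIdempotentElem
    constructor
    · rw [Finset.sum_mul, Finset.sum_eq_single_of_mem p hp fun s hs hsp ↦ horth hs hp hsp, hpp]
    · rw [Finset.mul_sum, Finset.sum_eq_single_of_mem p hp fun s hs hsp ↦ horth hp hs hsp.symm,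
        hpp]
  have hFG : ∀ p ∈ F, ∀ s ∈ G, p * s = 0 ∧ s * p = 0 := by
    intro p hp s hs
    obtain ⟨h₁, h₂⟩ := hsupp hF hForth hFsum p hp
    obtain ⟨h₃, h₄⟩ := hsupp hG hGorth hGsum s hs
    constructor
    · rw [← h₂, ← h₃, mul_assoc, ← mul_assoc q, mul_sub, hqf, hqq, sub_self, zero_mul, mul_zero]
    · rw [← h₁, ← h₄, mul_assoc, ← mul_assoc (f - q), sub_mul, hfq, hqq, sub_self, zero_mul,
        mul_zero]
  have hdisj : Disjoint F G := by
    rw [Finset.disjoint_left]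
    intro p hp hp'
    have hpp : p * p = p := (hF p hp).isStarProjection.isIdempotentElem
    exact (hF p hp).ne_zero (hpp ▸ (hFG p hp p hp').1)
  refine ⟨F ∪ G, ?_, ?_, ?_⟩
  · intro p hp
    exact (Finset.mem_union.mp hp).elim (hF p) (hG p)
  · intro p hp s hs hps
    rcases Finset.mem_union.mp hp with hp | hp <;> rcases Finset.mem_union.mp hs with hs | hs
    · exact hForth hp hs hps
    · exact (hFG p hp s hs).1
    · exact (hFG s hs p hp).2
    · exact hGorth hp hs hps
  · rw [Finset.sum_union hdisj, hFsum, hGsum, add_sub_cancel]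

theorem hasOrthogonalUnitaries_one (hB : IsEmpty (B →⋆ₐ[ℂ] ℂ)) {φ : B →ₗ[ℂ] ℂ}
    (hφ : ∀ a b, φ (a * b) = φ (b * a)) : HasOrthogonalUnitaries φ (1 : B) := by
  obtain ⟨F, hF, horth, hsum⟩ :=
    IsStarProjection.exists_sum_isMinimalProjection (1 : B) (.one B)
  rw [← hsum]
  refine HasOrthogonalUnitaries.sum hφ F (fun p hp ↦ (hF p hp).isStarProjection) horth ?_
  intro p hp
  by_contra! hnone
  refine (not_isEmpty_iff.mpr ((hF p hp).nonempty_starAlgHom fun b ↦ ?_)) hB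
  have hzero : ∀ q ∈ F, q ≠ p → q * (b * p) = 0 := by
    intro q hq hqp
    by_contra hne
    rw [← mul_assoc] at hne
    exact hnone q hq hqp ((hF p hp).equiv_of_mul_mul_ne_zero (hF q hq) hne)
  calc p * b * p = ∑ q ∈ F, q * (b * p) := by
        rw [Finset.sum_eq_single_of_mem p hp hzero, mul_assoc]
    _ = b * p := by rw [← Finset.sum_mul, hsum, one_mul]

end CStarAlgebra

/-- If a unital C*-algebra `A` with a normalized trace `τ` contains (via a unital
*-homomorphism) a finite-dimensional C*-algebra `B` admitting no character (no unital
*-homomorphism onto `ℂ`, i.e. no direct summand `ℂ`), then there are unitaries `u, v` in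
the image of `B` with `τ(u) = τ(v) = τ(v* u) = 0`. -/
theorem exists_orthonormal_unitaries_of_no_character
    (A : Type*) [NormedRing A] [StarRing A] [CStarRing A] [CompleteSpace A]
    [NormedAlgebra ℂ A] [StarModule ℂ A]
    (B : Type*) [NormedRing B] [StarRing B] [CStarRing B] [CompleteSpace B]
    [NormedAlgebra ℂ B] [StarModule ℂ B] [FiniteDimensional ℂ B]
    (hB : IsEmpty (B →⋆ₐ[ℂ] ℂ))
    (τ : A →ₗ[ℂ] ℂ) (hτ1 : τ 1 = 1)
    (hpos : ∀ a : A, 0 ≤ τ (star a * a))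
    (htrace : ∀ a b : A, τ (a * b) = τ (b * a))
    (ι : B →⋆ₐ[ℂ] A) :
    ∃ u v : A, u ∈ Set.range ι ∧ v ∈ Set.range ι ∧
      u ∈ unitary A ∧ v ∈ unitary A ∧
      τ u = 0 ∧ τ v = 0 ∧ τ (star v * u) = 0 := by
  let _ : CStarAlgebra B := {}
  obtain ⟨u, v, hu, hu', hv, hv', h₁, h₂, h₃⟩ :=
    hasOrthogonalUnitaries_one hB (φ := τ ∘ₗ ι.toAlgHom.toLinearMap)
      fun a b ↦ by simpa using htrace (ι a) (ι b)
  refine ⟨ι u, ι v, ⟨u, rfl⟩, ⟨v, rfl⟩, ?_, ?_, h₁, h₂, ?_⟩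
  · exact Unitary.map_mem ι (Unitary.mem_iff.mpr ⟨hu, hu'⟩)
  · exact Unitary.map_mem ι (Unitary.mem_iff.mpr ⟨hv, hv'⟩)
  · rw [← map_star, ← map_mul]
    exact h₃
end

section
/- Let A be a separable unital C*-algebra with a faithful normalized trace τ, and equip A with the inner product ⟨a,b⟩ = τ(b*a). Let F ⊆ A be a finite orthonormal set containing 1. Then there exists a countable set X ⊆ A with F ⊆ X and 1 ∈ X such that X is orthonormal (τ(y*x) = 1 if x = y and τ(y*x) = 0 if x ≠ y, for x, y ∈ X), the linear span of X is closed under adjoints and under products, and the linear span of X is dense in A with respect to the C*-norm; that is, X is a standard orthonormal basis for A containing F. -/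
open scoped ComplexOrder

open InnerProductSpace in
/-- A finite orthonormal set can be completed, by adjoining countably many vectors, to an
orthonormal set spanning the same subspace as the finite set and a given countable set. -/
theorem exists_countable_orthonormal_extension {𝕜 E : Type*} [RCLike 𝕜] [NormedAddCommGroup E]
    [InnerProductSpace 𝕜 E] (F : Finset E) (hnorm : ∀ x ∈ F, inner 𝕜 x x = 1)
    (horth : ∀ x ∈ F, ∀ y ∈ F, x ≠ y → inner 𝕜 y x = 0) (S : Set E) (hS : S.Countable)
    (hne : S.Nonempty) :
    ∃ X : Set E, X.Countable ∧ ↑F ⊆ X ∧ (∀ x ∈ X, inner 𝕜 x x = 1) ∧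
      (∀ x ∈ X, ∀ y ∈ X, x ≠ y → inner 𝕜 y x = 0) ∧
      Submodule.span 𝕜 X = Submodule.span 𝕜 (↑F ∪ S) := by
  obtain ⟨v, rfl⟩ := hS.exists_eq_range hne
  set p : E → E := fun a => ∑ f ∈ F, inner 𝕜 f a • f with hp
  have hpF (a : E) : p a ∈ Submodule.span 𝕜 (F : Set E) :=
    Submodule.sum_mem _ fun f hf => Submodule.smul_mem _ _ (Submodule.subset_span hf)
  set w : ℕ → E := fun n => v n - p (v n) with hw
  have hwF (n : ℕ) (f : E) (hf : f ∈ F) : inner 𝕜 f (w n) = 0 := by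
    simp only [hw, hp, inner_sub_right, inner_sum, inner_smul_right]
    rw [Finset.sum_eq_single_of_mem f hf]
    · rw [hnorm f hf, mul_one, sub_self]
    · intro g hg hgf
      simp [horth g hg f hf hgf]
  set u : ℕ → E := gramSchmidtNormed 𝕜 w with hu
  have hspan : Submodule.span 𝕜 (Set.range u) = Submodule.span 𝕜 (Set.range w) := by
    rw [hu, span_gramSchmidtNormed_range, span_gramSchmidt]
  have huF (n : ℕ) (f : E) (hf : f ∈ F) : inner 𝕜 f (u n) = 0 := by
    have h : u n ∈ Submodule.span 𝕜 (Set.range w) :=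
      hspan ▸ Submodule.subset_span (Set.mem_range_self n)
    generalize u n = z at h
    induction h using Submodule.span_induction with
    | mem x hx => obtain ⟨m, rfl⟩ := hx; exact hwF m f hf
    | zero => simp
    | add x y _ _ hx hy => rw [inner_add_right, hx, hy, add_zero]
    | smul c x _ hx => rw [inner_smul_right, hx, mul_zero]
  refine ⟨↑F ∪ (Set.range u \ {0}), ?_, Set.subset_union_left, ?_, ?_, ?_⟩
  · exact F.countable_toSet.union ((Set.countable_range u).mono Set.sdiff_subset)
  · rintro x (hx | ⟨⟨n, rfl⟩, hn⟩)
    · exact hnorm x hx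
    · rw [inner_self_eq_norm_sq_to_K, gramSchmidtNormed_unit_length' hn]
      simp
  · rintro x (hx | ⟨⟨n, rfl⟩, hn⟩) y (hy | ⟨⟨m, rfl⟩, hm⟩) hxy
    · exact horth x hx y hy hxy
    · exact inner_eq_zero_symm.mp (huF m x hx)
    · exact huF n y hy
    · have hmn : m ≠ n := fun h => hxy (h ▸ rfl)
      simp only [hu, gramSchmidtNormed, inner_smul_left, inner_smul_right,
        gramSchmidt_orthogonal 𝕜 w hmn, mul_zero]
  · rw [Submodule.span_union, Submodule.span_union, Submodule.span_sdiff_singleton_zero, hspan]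
    apply le_antisymm
    · refine sup_le le_sup_left (Submodule.span_le.mpr ?_)
      rintro _ ⟨n, rfl⟩
      exact Submodule.sub_mem _
        (Submodule.mem_sup_right (Submodule.subset_span (Set.mem_range_self n)))
        (Submodule.mem_sup_left (hpF _))
    · refine sup_le le_sup_left (Submodule.span_le.mpr ?_)
      rintro _ ⟨n, rfl⟩
      have h : v n = w n + p (v n) := (sub_add_cancel _ _).symm
      rw [h]
      exact Submodule.add_mem _
        (Submodule.mem_sup_right (Submodule.subset_span (Set.mem_range_self n)))
        (Submodule.mem_sup_left (hpF _))

/-- A positive linear functional on a unital complex *-algebra is hermitian. -/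
theorem map_star_of_forall_star_mul_self_nonneg {A : Type*} [Ring A] [StarRing A] [Algebra ℂ A]
    [StarModule ℂ A] (τ : A →ₗ[ℂ] ℂ) (hpos : ∀ a : A, 0 ≤ τ (star a * a)) (a : A) :
    τ (star a) = star (τ a) := by
  have him (b : A) : (τ (star b * b)).im = 0 := (Complex.nonneg_iff.mp (hpos b)).2.symm
  have h1 := him 1
  have ha := him a
  have hadd := him (1 + a)
  have hI := him (1 + Complex.I • a)
  simp only [star_one, mul_one] at h1
  simp only [star_add, star_one, star_smul, add_mul, mul_add, one_mul, mul_one, map_add,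
    smul_mul_assoc, mul_smul_comm, map_smul, smul_eq_mul, Complex.add_im, Complex.mul_im,
    Complex.mul_re, Complex.I_re, Complex.I_im, Complex.star_def, Complex.conj_I, Complex.neg_re,
    Complex.neg_im] at hadd hI
  apply Complex.ext
  · simp only [Complex.star_def, Complex.conj_re]; linarith
  · simp only [Complex.star_def, Complex.conj_im]; linarith

/-- The inner product `⟪a, b⟫ = τ (star a * b)` of a faithful positive linear functional `τ`. -/
@[reducible] def innerProductCoreOfFaithful {A : Type*} [Ring A] [StarRing A] [Algebra ℂ A]
    [StarModule ℂ A] (τ : A →ₗ[ℂ] ℂ) (hpos : ∀ a : A, 0 ≤ τ (star a * a))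
    (hfaithful : ∀ a : A, τ (star a * a) = 0 → a = 0) : InnerProductSpace.Core ℂ A where
  inner a b := τ (star a * b)
  conj_inner_symm a b := by
    have h := map_star_of_forall_star_mul_self_nonneg τ hpos (star b * a)
    rw [star_mul, star_star] at h
    exact h.symm
  re_inner_nonneg a := (Complex.nonneg_iff.mp (hpos a)).1
  add_left a b c := by simp [add_mul]
  smul_left a b r := by simp
  definite a := hfaithful a

/-- Every countable subset of a *-algebra is contained in a countable set that contains `1` and
whose linear span is a *-subalgebra. -/
theorem exists_countable_span_star_mul_mem {A : Type*} [Ring A] [StarRing A] [Algebra ℂ A]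
    [StarModule ℂ A] (D : Set A) (hD : D.Countable) :
    ∃ S : Set A, S.Countable ∧ 1 ∈ S ∧ D ⊆ S ∧
      (∀ a ∈ Submodule.span ℂ S, star a ∈ Submodule.span ℂ S) ∧
      (∀ a ∈ Submodule.span ℂ S, ∀ b ∈ Submodule.span ℂ S, a * b ∈ Submodule.span ℂ S) := by
  have hspan : Submodule.span ℂ (Submonoid.closure (D ∪ star D) : Set A) =
      Subalgebra.toSubmodule (StarAlgebra.adjoin ℂ D).toSubalgebra := by
    rw [StarAlgebra.adjoin_toSubalgebra, Algebra.adjoin_eq_span]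
  refine ⟨Submonoid.closure (D ∪ star D), ?_, one_mem _,
    Set.subset_union_left.trans Submonoid.subset_closure, ?_, ?_⟩
  · have hstar : (star D).Countable := by
      rw [← Set.image_star]
      exact hD.image star
    have : Countable ↥(D ∪ star D) := (hD.union hstar).to_subtype
    rw [Submonoid.closure_eq_image_prod]
    refine Set.Countable.image ?_ _
    have h : {l : List A | ∀ x ∈ l, x ∈ D ∪ star D} =
        Set.range (List.map ((↑) : ↥(D ∪ star D) → A)) := by
      rw [Set.range_list_map_coe]
    rw [h]
    exact Set.countable_range _
  · rw [hspan]
    exact fun a ha => (StarAlgebra.adjoin ℂ D).star_mem' ha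
  · rw [hspan]
    exact fun a ha b hb => (StarAlgebra.adjoin ℂ D).mul_mem' ha hb

/-- In a separable unital C*-algebra with a faithful normalized trace, every finite
orthonormal set containing `1` extends to a countable standard orthonormal basis: an
orthonormal set `X` containing `1` whose linear span is a dense *-subalgebra. -/
theorem exists_standard_orthonormal_basis
    (A : Type*) [NormedRing A] [StarRing A] [CStarRing A] [CompleteSpace A]
    [NormedAlgebra ℂ A] [StarModule ℂ A] [TopologicalSpace.SeparableSpace A]
    (τ : A →ₗ[ℂ] ℂ) (hτ1 : τ 1 = 1)
    (hpos : ∀ a : A, 0 ≤ τ (star a * a))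
    (htrace : ∀ a b : A, τ (a * b) = τ (b * a))
    (hfaithful : ∀ a : A, τ (star a * a) = 0 → a = 0)
    (F : Finset A) (hF1 : (1 : A) ∈ F)
    (hFnorm : ∀ x ∈ F, τ (star x * x) = 1)
    (hForth : ∀ x ∈ F, ∀ y ∈ F, x ≠ y → τ (star y * x) = 0) :
    ∃ X : Set A, X.Countable ∧ ↑F ⊆ X ∧ (1 : A) ∈ X ∧
      (∀ x ∈ X, τ (star x * x) = 1) ∧
      (∀ x ∈ X, ∀ y ∈ X, x ≠ y → τ (star y * x) = 0) ∧
      (∀ a ∈ Submodule.span ℂ X, star a ∈ Submodule.span ℂ X) ∧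
      (∀ a ∈ Submodule.span ℂ X, ∀ b ∈ Submodule.span ℂ X,
        a * b ∈ Submodule.span ℂ X) ∧
      Dense (Submodule.span ℂ X : Set A) := by
  obtain ⟨D, hDc, hDd⟩ := TopologicalSpace.exists_countable_dense A
  obtain ⟨S, hSc, hS1, hDS, hstar, hmul⟩ :=
    exists_countable_span_star_mul_mem (↑F ∪ D) (F.countable_toSet.union hDc)
  let core := innerProductCoreOfFaithful τ hpos hfaithful
  obtain ⟨X, hXc, hFX, hXnorm, hXorth, hXspan⟩ :=
    @exists_countable_orthonormal_extension ℂ A _ core.toNormedAddCommGroup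
      (InnerProductSpace.ofCore core.toCore) F hFnorm hForth S hSc ⟨1, hS1⟩
  have hX : Submodule.span ℂ X = Submodule.span ℂ S := by
    rw [← Set.union_eq_self_of_subset_left (Set.subset_union_left.trans hDS)]
    exact hXspan
  refine ⟨X, hXc, hFX, hFX hF1, hXnorm, hXorth, ?_, ?_, ?_⟩
  · rwa [hX]
  · rwa [hX]
  · rw [hX]
    exact hDd.mono ((Set.subset_union_right.trans hDS).trans Submodule.subset_span)
end
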